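/- arXiv:1002.4123 — 2 statements merged into one kernel-verified Lean document; each statement's English description precedes it below -/
import Mathlib

section
/- Let t0 < T, r ∈ ℕ, and let C, Q, S : [t0,T] → ℝ^{r×r} be continuous with Q(t) and S(t) symmetric positive semidefinite for every t. Then for every ℓ1 ∈ ℝʳ the linear Hamiltonian boundary value problem z'(t) = C(t)z(t) + Q(t)p(t), p'(t) = −C'(t)p(t) + S(t)z(t), with boundary conditions p(t0) = 0 and z(T) + p(T) = ℓ1, has exactly one solution pair (z, p) of continuously differentiable functions [t0,T] → ℝʳ. (Solvability of the non-negative Hamiltonian system (eq:ebvp), claimed in the proof of Corollary 1.) -/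
open Matrix Set

noncomputable section

/-- `(z, p)` is a (continuously differentiable) solution of the linear Hamiltonian
boundary value problem `z' = Cz + Qp`, `p' = −C'p + Sz`, `p(t0) = 0`, `z(T) + p(T) = ℓ1`. -/
def IsHamiltonianBVPSol (t0 T : ℝ) {r : ℕ} (C Q S : ℝ → Matrix (Fin r) (Fin r) ℝ)
    (ℓ1 : Fin r → ℝ) (z p : ℝ → (Fin r → ℝ)) : Prop :=
  (∀ t ∈ Icc t0 T,
    HasDerivWithinAt z ((C t) *ᵥ z t + (Q t) *ᵥ p t) (Icc t0 T) t) ∧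
  (∀ t ∈ Icc t0 T,
    HasDerivWithinAt p (-((C t)ᵀ *ᵥ p t) + (S t) *ᵥ z t) (Icc t0 T) t) ∧
  p t0 = 0 ∧ z T + p T = ℓ1

/-- A continuous family of operators on a compact interval is uniformly bounded. -/
lemma exists_nnnorm_le_of_continuousOn_Icc {F : Type*} [NormedAddCommGroup F] {a b : ℝ}
    {A : ℝ → F} (hA : ContinuousOn A (Icc a b)) :
    ∃ M : NNReal, ∀ t ∈ Icc a b, ‖A t‖₊ ≤ M := by
  obtain ⟨M, hM⟩ := isCompact_Icc.exists_bound_of_continuousOn hA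
  exact ⟨M.toNNReal, fun t ht => NNReal.le_toNNReal_of_coe_le (hM t ht)⟩

section LinearODE

variable {E : Type*} [NormedAddCommGroup E] [NormedSpace ℝ E] {a b : ℝ} {A : ℝ → E →L[ℝ] E}
  {x y : ℝ → E}

lemma IsIntegralCurveOn.eqOn_Icc_of_eq_left (hA : ContinuousOn A (Icc a b))
    (hx : IsIntegralCurveOn x (fun t => A t) (Icc a b))
    (hy : IsIntegralCurveOn y (fun t => A t) (Icc a b)) (h : x a = y a) :
    EqOn x y (Icc a b) := by
  obtain ⟨M, hM⟩ := exists_nnnorm_le_of_continuousOn_Icc hA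
  have right {w : ℝ → E} (hw : IsIntegralCurveOn w (fun t => A t) (Icc a b)) :
      ∀ t ∈ Ico a b, HasDerivWithinAt w (A t (w t)) (Ici t) t := fun t ht =>
    (hw t (Ico_subset_Icc_self ht)).mono_of_mem_nhdsWithin (Icc_mem_nhdsGE_of_mem ht)
  exact ODE_solution_unique_of_mem_Icc_right (s := fun _ => univ) (v := fun t => A t) (K := M)
    (fun t ht => ((A t).lipschitz.weaken (hM t (Ico_subset_Icc_self ht))).lipschitzOnWith)
    hx.continuousOn (right hx) (fun _ _ => mem_univ _)
    hy.continuousOn (right hy) (fun _ _ => mem_univ _) h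

lemma IsIntegralCurveOn.eqOn_Icc_of_eq_right (hA : ContinuousOn A (Icc a b))
    (hx : IsIntegralCurveOn x (fun t => A t) (Icc a b))
    (hy : IsIntegralCurveOn y (fun t => A t) (Icc a b)) (h : x b = y b) :
    EqOn x y (Icc a b) := by
  obtain ⟨M, hM⟩ := exists_nnnorm_le_of_continuousOn_Icc hA
  have left {w : ℝ → E} (hw : IsIntegralCurveOn w (fun t => A t) (Icc a b)) :
      ∀ t ∈ Ioc a b, HasDerivWithinAt w (A t (w t)) (Iic t) t := fun t ht =>
    (hw t (Ioc_subset_Icc_self ht)).mono_of_mem_nhdsWithin (Icc_mem_nhdsLE_of_mem ht)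
  exact ODE_solution_unique_of_mem_Icc_left (s := fun _ => univ) (v := fun t => A t) (K := M)
    (fun t ht => ((A t).lipschitz.weaken (hM t (Ioc_subset_Icc_self ht))).lipschitzOnWith)
    hx.continuousOn (left hx) (fun _ _ => mem_univ _)
    hy.continuousOn (left hy) (fun _ _ => mem_univ _) h

/-- The coordinatewise truncation to `[-R, R]`. -/
def coordClamp {ι : Type*} (R : ℝ) (x : ι → ℝ) : ι → ℝ := fun i => max (-R) (min R (x i))

variable {ι : Type*} [Fintype ι]

lemma coordClamp_lipschitzWith (R : ℝ) : LipschitzWith 1 (coordClamp (ι := ι) R) := by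
  refine LipschitzWith.of_dist_le_mul fun x y => ?_
  rw [NNReal.coe_one, one_mul]
  refine (dist_pi_le_iff dist_nonneg).2 fun i => le_trans ?_ (dist_le_pi_dist x y i)
  have h := ((LipschitzWith.id (α := ℝ)).const_min R).const_max (-R)
  simpa [coordClamp] using h.dist_le_mul (x i) (y i)

lemma norm_coordClamp_le_radius {R : ℝ} (hR : 0 ≤ R) (x : ι → ℝ) : ‖coordClamp R x‖ ≤ R := by
  refine (pi_norm_le_iff_of_nonneg hR).2 fun i => abs_le.2 ?_
  exact ⟨le_max_left _ _, max_le (by linarith) (min_le_left _ _)⟩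

lemma coordClamp_eq_self {R : ℝ} {x : ι → ℝ} (hx : ‖x‖ ≤ R) : coordClamp R x = x := by
  funext i
  obtain ⟨h₁, h₂⟩ := abs_le.1 ((norm_le_pi_norm x i).trans hx)
  simp [coordClamp, h₁, h₂]

lemma norm_coordClamp_le {R : ℝ} (hR : 0 ≤ R) (x : ι → ℝ) : ‖coordClamp R x‖ ≤ ‖x‖ := by
  have h := (coordClamp_lipschitzWith (ι := ι) R).dist_le_mul x 0
  rwa [coordClamp_eq_self (x := 0) (by simpa using hR), dist_zero_right, dist_zero_right,
    NNReal.coe_one, one_mul] at h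

/-- A linear ODE with continuous coefficients has a solution on the whole interval. -/
lemma exists_isIntegralCurveOn_Icc_of_linear {A : ℝ → (ι → ℝ) →L[ℝ] (ι → ℝ)} (hab : a ≤ b)
    (hA : ContinuousOn A (Icc a b)) (v : ι → ℝ) :
    ∃ x : ℝ → (ι → ℝ), x a = v ∧ IsIntegralCurveOn x (fun t => A t) (Icc a b) := by
  obtain ⟨M, hM⟩ := exists_nnnorm_le_of_continuousOn_Icc hA
  have hAM (t) (ht : t ∈ Icc a b) (u : ι → ℝ) : ‖A t u‖ ≤ M * ‖u‖ :=
    (A t).le_of_opNorm_le (hM t ht) u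
  -- By Grönwall's inequality the truncation at radius `R` is never active.
  let R : NNReal := ⟨‖v‖ * Real.exp (M * (b - a)), by positivity⟩
  have hPL : IsPicardLindelof (fun t u => A t (coordClamp R u)) (⟨a, left_mem_Icc.2 hab⟩ : Icc a b)
      v (M * R * (b - a).toNNReal) 0 (M * R) M := by
    refine ⟨fun t ht => ?_, fun u _ => hA.clm_apply continuousOn_const, fun t ht u _ => ?_, ?_⟩
    · have h := ((A t).lipschitz.weaken (hM t ht)).comp (coordClamp_lipschitzWith (ι := ι) R)
      rw [mul_one] at h
      exact h.lipschitzOnWith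
    · refine (hAM t ht _).trans ?_
      rw [NNReal.coe_mul]
      gcongr
      exact norm_coordClamp_le_radius R.2 u
    · simp [hab]
  obtain ⟨x, hxa, hx⟩ := hPL.exists_eq_forall_mem_Icc_hasDerivWithinAt₀
  have hbound : ∀ t ∈ Icc a b, ‖x t‖ ≤ R := by
    intro t ht
    have h := norm_le_gronwallBound_of_norm_deriv_right_le (δ := ‖v‖) (K := M) (ε := 0)
      (fun t ht => (hx t ht).continuousWithinAt)
      (fun t ht => (hx t (Ico_subset_Icc_self ht)).mono_of_mem_nhdsWithin
        (Icc_mem_nhdsGE_of_mem ht))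
      (by rw [← hxa])
      (fun t ht => by
        rw [add_zero]
        refine (hAM t (Ico_subset_Icc_self ht) _).trans ?_
        gcongr
        exact norm_coordClamp_le R.2 _) t ht
    rw [gronwallBound_ε0] at h
    refine h.trans ?_
    change _ ≤ ‖v‖ * Real.exp (M * (b - a))
    gcongr
    exact ht.2
  refine ⟨x, hxa, fun t ht => ?_⟩
  simpa [coordClamp_eq_self (hbound t ht)] using hx t ht

end LinearODE

section Hamiltonian

variable {t0 T : ℝ} {r : ℕ} {C Q S : ℝ → Matrix (Fin r) (Fin r) ℝ} {ℓ ℓ' : Fin r → ℝ}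
  {z p z' p' : ℝ → Fin r → ℝ}

/-- The operator of the Hamiltonian system, acting on the stacked vector `(z, p)`. -/
def hamiltonianOp (C Q S : ℝ → Matrix (Fin r) (Fin r) ℝ) (t : ℝ) :
    (Fin r ⊕ Fin r → ℝ) →L[ℝ] (Fin r ⊕ Fin r → ℝ) :=
  LinearMap.toContinuousLinearMap (Matrix.toLin' (fromBlocks (C t) (Q t) (S t) (-(C t)ᵀ)))

lemma continuousOn_hamiltonianOp {s : Set ℝ} (hC : ContinuousOn C s) (hQ : ContinuousOn Q s)
    (hS : ContinuousOn S s) : ContinuousOn (hamiltonianOp C Q S) s := by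
  let L : Matrix (Fin r ⊕ Fin r) (Fin r ⊕ Fin r) ℝ →ₗ[ℝ]
      (Fin r ⊕ Fin r → ℝ) →L[ℝ] (Fin r ⊕ Fin r → ℝ) :=
    LinearMap.toContinuousLinearMap.toLinearMap ∘ₗ Matrix.toLin'.toLinearMap
  have hL : Continuous L := L.continuous_of_finiteDimensional
  refine hL.comp_continuousOn
    (f := fun t => fromBlocks (C t) (Q t) (S t) (-(C t)ᵀ)) ?_
  have hB : Continuous fun m : Matrix (Fin r) (Fin r) ℝ × Matrix (Fin r) (Fin r) ℝ ×
      Matrix (Fin r) (Fin r) ℝ => fromBlocks m.1 m.2.1 m.2.2 (-m.1ᵀ) := by fun_prop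
  exact hB.comp_continuousOn (hC.prodMk (hQ.prodMk hS))

lemma isIntegralCurveOn_hamiltonianOp_iff {x : ℝ → Fin r ⊕ Fin r → ℝ} {s : Set ℝ} :
    IsIntegralCurveOn x (fun t => hamiltonianOp C Q S t) s ↔
      (∀ t ∈ s, HasDerivWithinAt (fun t => x t ∘ Sum.inl)
        (C t *ᵥ (x t ∘ Sum.inl) + Q t *ᵥ (x t ∘ Sum.inr)) s t) ∧
      (∀ t ∈ s, HasDerivWithinAt (fun t => x t ∘ Sum.inr)
        (-((C t)ᵀ *ᵥ (x t ∘ Sum.inr)) + S t *ᵥ (x t ∘ Sum.inl)) s t) := by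
  simp only [IsIntegralCurveOn, hasDerivWithinAt_pi, hamiltonianOp,
    LinearMap.coe_toContinuousLinearMap', Matrix.toLin'_apply, fromBlocks_mulVec, Sum.forall,
    Sum.elim_inl, Sum.elim_inr, Function.comp_apply, neg_mulVec, ← forall_and]
  simp only [add_comm (-_) (S _ *ᵥ _), forall_and]

lemma IsHamiltonianBVPSol.isIntegralCurveOn (h : IsHamiltonianBVPSol t0 T C Q S ℓ z p) :
    IsIntegralCurveOn (fun t => Sum.elim (z t) (p t)) (fun t => hamiltonianOp C Q S t)
      (Icc t0 T) :=
  isIntegralCurveOn_hamiltonianOp_iff.2 ⟨h.1, h.2.1⟩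

lemma IsHamiltonianBVPSol.sub (h : IsHamiltonianBVPSol t0 T C Q S ℓ z p)
    (h' : IsHamiltonianBVPSol t0 T C Q S ℓ' z' p') :
    IsHamiltonianBVPSol t0 T C Q S (ℓ - ℓ') (z - z') (p - p') := by
  obtain ⟨hz, hp, h0, h1⟩ := h
  obtain ⟨hz', hp', h0', h1'⟩ := h'
  refine ⟨fun t ht => ?_, fun t ht => ?_, by simp [h0, h0'], ?_⟩
  · refine ((hz t ht).sub (hz' t ht)).congr_deriv ?_
    simp only [Pi.sub_apply, mulVec_sub]
    abel
  · refine ((hp t ht).sub (hp' t ht)).congr_deriv ?_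
    simp only [Pi.sub_apply, mulVec_sub]
    abel
  · rw [← h1, ← h1', Pi.sub_apply, Pi.sub_apply]
    abel

/-- The homogeneous boundary value problem has only the zero solution: `z ⬝ᵥ p` is nondecreasing,
vanishes at `t0` and equals `-‖p T‖²` at `T`. -/
lemma IsHamiltonianBVPSol.eq_zero (hT : t0 < T)
    (hC : ContinuousOn C (Icc t0 T)) (hQ : ContinuousOn Q (Icc t0 T))
    (hS : ContinuousOn S (Icc t0 T))
    (hQpsd : ∀ t ∈ Icc t0 T, (Q t).PosSemidef) (hSpsd : ∀ t ∈ Icc t0 T, (S t).PosSemidef)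
    (h : IsHamiltonianBVPSol t0 T C Q S 0 z p) : ∀ t ∈ Icc t0 T, z t = 0 ∧ p t = 0 := by
  have hx := h.isIntegralCurveOn
  obtain ⟨hz, hp, h0, h1⟩ := h
  have hderiv : ∀ t ∈ Icc t0 T, HasDerivWithinAt (fun t => z t ⬝ᵥ p t)
      (p t ⬝ᵥ Q t *ᵥ p t + z t ⬝ᵥ S t *ᵥ z t) (Icc t0 T) t := by
    intro t ht
    have hsum := HasDerivWithinAt.fun_sum (u := Finset.univ) fun i (_ : i ∈ Finset.univ) =>
      (hasDerivWithinAt_pi.1 (hz t ht) i).mul (hasDerivWithinAt_pi.1 (hp t ht) i)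
    refine hsum.congr_deriv ?_
    rw [Finset.sum_add_distrib]
    change (C t *ᵥ z t + Q t *ᵥ p t) ⬝ᵥ p t + z t ⬝ᵥ (-((C t)ᵀ *ᵥ p t) + S t *ᵥ z t) = _
    rw [add_dotProduct, dotProduct_add, dotProduct_neg, mulVec_transpose,
      dotProduct_comm (z t) (p t ᵥ* C t), ← dotProduct_mulVec, dotProduct_comm (C t *ᵥ z t),
      dotProduct_comm (Q t *ᵥ p t)]
    ring
  have hmono : MonotoneOn (fun t => z t ⬝ᵥ p t) (Icc t0 T) := by
    refine monotoneOn_of_hasDerivWithinAt_nonneg (convex_Icc t0 T)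
      (fun t ht => (hderiv t ht).continuousWithinAt)
      (fun t ht => (hderiv t (interior_subset ht)).mono interior_subset) fun t ht => ?_
    have hQt := (hQpsd t (interior_subset ht)).dotProduct_mulVec_nonneg (p t)
    have hSt := (hSpsd t (interior_subset ht)).dotProduct_mulVec_nonneg (z t)
    simp only [star_trivial] at hQt hSt
    exact add_nonneg hQt hSt
  have hle := hmono (left_mem_Icc.2 hT.le) (right_mem_Icc.2 hT.le) hT.le
  have hzT : z T = -p T := eq_neg_of_add_eq_zero_left h1
  have hpT : p T = 0 := by
    simp only [h0, hzT, dotProduct_zero, neg_dotProduct] at hle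
    refine dotProduct_self_eq_zero.1 (le_antisymm (by linarith) ?_)
    exact Finset.sum_nonneg fun i _ => mul_self_nonneg _
  have hzero : IsIntegralCurveOn (0 : ℝ → Fin r ⊕ Fin r → ℝ) (fun t => hamiltonianOp C Q S t)
      (Icc t0 T) := fun t _ =>
    (hasDerivWithinAt_const t (Icc t0 T) (0 : Fin r ⊕ Fin r → ℝ)).congr_deriv
      (map_zero (hamiltonianOp C Q S t)).symm
  have heq := hx.eqOn_Icc_of_eq_right (continuousOn_hamiltonianOp hC hQ hS) hzero
    (by funext i; cases i <;> simp [hzT, hpT])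
  intro t ht
  exact ⟨funext fun i => congrFun (heq ht) (Sum.inl i),
    funext fun i => congrFun (heq ht) (Sum.inr i)⟩

/-- Shooting from `t0`: the terminal value `z T + p T` depends linearly on `z t0`. -/
lemma exists_linearMap_isHamiltonianBVPSol (hT : t0 < T)
    (hC : ContinuousOn C (Icc t0 T)) (hQ : ContinuousOn Q (Icc t0 T))
    (hS : ContinuousOn S (Icc t0 T)) :
    ∃ L : (Fin r → ℝ) →ₗ[ℝ] (Fin r → ℝ), ∀ v, ∃ z p : ℝ → Fin r → ℝ,
      z t0 = v ∧ IsHamiltonianBVPSol t0 T C Q S (L v) z p := by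
  have hA := continuousOn_hamiltonianOp hC hQ hS
  choose x hx0 hx using fun v : Fin r → ℝ =>
    exists_isIntegralCurveOn_Icc_of_linear hT.le hA (Sum.elim v 0)
  have hTmem : T ∈ Icc t0 T := right_mem_Icc.2 hT.le
  have hadd (v w : Fin r → ℝ) : x (v + w) T = x v T + x w T := by
    have hsum : IsIntegralCurveOn (x v + x w) (fun t => hamiltonianOp C Q S t) (Icc t0 T) :=
      fun t ht => by simpa using (hx v t ht).add (hx w t ht)
    refine (hx (v + w)).eqOn_Icc_of_eq_left hA hsum ?_ hTmem
    rw [Pi.add_apply, hx0, hx0, hx0]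
    funext i
    cases i <;> simp
  have hsmul (c : ℝ) (v : Fin r → ℝ) : x (c • v) T = c • x v T := by
    have hscaled : IsIntegralCurveOn (c • x v) (fun t => hamiltonianOp C Q S t) (Icc t0 T) :=
      fun t ht => by simpa using (hx v t ht).const_smul c
    refine (hx (c • v)).eqOn_Icc_of_eq_left hA hscaled ?_ hTmem
    rw [Pi.smul_apply, hx0, hx0]
    funext i
    cases i <;> simp
  refine ⟨{ toFun := fun v => x v T ∘ Sum.inl + x v T ∘ Sum.inr
            map_add' := fun v w => ?_
            map_smul' := fun c v => ?_ },
    fun v => ⟨fun t => x v t ∘ Sum.inl, fun t => x v t ∘ Sum.inr, ?_, ?_, ?_, ?_, rfl⟩⟩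
  · funext i
    simp only [hadd, Pi.add_apply, Function.comp_apply]
    ring
  · funext i
    simp [hsmul, mul_add]
  · simp [hx0]
  · exact (isIntegralCurveOn_hamiltonianOp_iff.1 (hx v)).1
  · exact (isIntegralCurveOn_hamiltonianOp_iff.1 (hx v)).2
  · simp [hx0]

end Hamiltonian

/-- solvability of the non-negative Hamiltonian system (eq:ebvp).
If `C, Q, S` are continuous on `[t0,T]` with `Q(t)`, `S(t)` symmetric positive
semidefinite, then for every `ℓ1` the boundary value problem `z' = Cz + Qp`,
`p' = −C'p + Sz`, `p(t0) = 0`, `z(T) + p(T) = ℓ1` has exactly one C¹ solution pair. -/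
theorem hamiltonian_bvp_existsUnique (t0 T : ℝ) (hT : t0 < T) (r : ℕ)
    (C Q S : ℝ → Matrix (Fin r) (Fin r) ℝ)
    (hC : ContinuousOn C (Icc t0 T)) (hQ : ContinuousOn Q (Icc t0 T))
    (hS : ContinuousOn S (Icc t0 T))
    (hQpsd : ∀ t ∈ Icc t0 T, (Q t).PosSemidef)
    (hSpsd : ∀ t ∈ Icc t0 T, (S t).PosSemidef)
    (ℓ1 : Fin r → ℝ) :
    ∃ (z p : ℝ → (Fin r → ℝ)),
      IsHamiltonianBVPSol t0 T C Q S ℓ1 z p ∧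
      ∀ (z' p' : ℝ → (Fin r → ℝ)),
        IsHamiltonianBVPSol t0 T C Q S ℓ1 z' p' →
          ∀ t ∈ Icc t0 T, z' t = z t ∧ p' t = p t := by
  obtain ⟨L, hL⟩ := exists_linearMap_isHamiltonianBVPSol hT hC hQ hS
  have hinj : Function.Injective L := by
    refine (injective_iff_map_eq_zero L).2 fun v hv => ?_
    obtain ⟨z, p, hz0, hsol⟩ := hL v
    rw [hv] at hsol
    rw [← hz0]
    exact (hsol.eq_zero hT hC hQ hS hQpsd hSpsd t0 (left_mem_Icc.2 hT.le)).1
  obtain ⟨v, rfl⟩ := LinearMap.injective_iff_surjective.1 hinj ℓ1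
  obtain ⟨z, p, -, hsol⟩ := hL v
  refine ⟨z, p, hsol, fun z' p' hsol' t ht => ?_⟩
  have hdiff := hsol'.sub hsol
  rw [sub_self] at hdiff
  obtain ⟨hz, hp⟩ := hdiff.eq_zero hT hC hQ hS hQpsd hSpsd t ht
  exact ⟨sub_eq_zero.1 hz, sub_eq_zero.1 hp⟩
end
end

section
/- Fix ε > 0 and ℓ = (ℓ1, ℓ2) ∈ ℝʳ × ℝ^{n−r}. Let K(·,ε) solve K' = −KC(·,ε) − C'(·,ε)K − KQ(·,ε)K + S(·,ε), K(t0) = 0; let z1 solve z1' = (C(·,ε) + Q(·,ε)K)z1 with z1(T) = (I + K(T,ε))⁻¹ℓ1; set Φ(t,ε) = [K(t,ε); M(t,ε)(εB(t) − A'(t)K(t,ε))] (an n×r block column) and p̂(t) = Φ(t,ε)z1(t). Then for every y ∈ L²(t0,T;ℝᵖ): ∫_{t0}^T ⟨(1/ε)R(t)H(t)p̂(t), y(t)⟩ dt = ⟨(I + K(T,ε))⁻¹ℓ1, x̂(T)⟩, where x̂ is the solution of x̂'(t) = (−C'(t,ε) − K(t,ε)Q(t,ε))x̂(t) + (1/ε)Φ'(t,ε)H'(t)R(t)y(t),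 x̂(t0) = 0. (Representation identity in the proof of Corollary 1: the suboptimal estimation is realized by a recursive filter.) -/
open Matrix Set
open scoped ENNReal

noncomputable section

section BlockDefs

variable {r mr nr : ℕ}

/-- `A(t) = C3'Q4⁻¹C4 + S2` (blocks taken conformally with `F = [[I,0],[0,0]]`,
`Sm = H'RH`). -/
def blkA (Cm : Matrix (Fin r ⊕ Fin mr) (Fin r ⊕ Fin nr) ℝ)
    (Qm : Matrix (Fin r ⊕ Fin mr) (Fin r ⊕ Fin mr) ℝ)
    (Sm : Matrix (Fin r ⊕ Fin nr) (Fin r ⊕ Fin nr) ℝ) : Matrix (Fin r) (Fin nr) ℝ :=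
  (Cm.toBlocks₂₁)ᵀ * (Qm.toBlocks₂₂)⁻¹ * Cm.toBlocks₂₂ + Sm.toBlocks₁₂

/-- `B(t) = C2' − C4'Q4⁻¹Q2'`. -/
def blkB (Cm : Matrix (Fin r ⊕ Fin mr) (Fin r ⊕ Fin nr) ℝ)
    (Qm : Matrix (Fin r ⊕ Fin mr) (Fin r ⊕ Fin mr) ℝ) : Matrix (Fin nr) (Fin r) ℝ :=
  (Cm.toBlocks₁₂)ᵀ - (Cm.toBlocks₂₂)ᵀ * (Qm.toBlocks₂₂)⁻¹ * (Qm.toBlocks₁₂)ᵀ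

/-- `W(t,ε) = εI + S4 + C4'Q4⁻¹C4`. -/
def blkW (Cm : Matrix (Fin r ⊕ Fin mr) (Fin r ⊕ Fin nr) ℝ)
    (Qm : Matrix (Fin r ⊕ Fin mr) (Fin r ⊕ Fin mr) ℝ)
    (Sm : Matrix (Fin r ⊕ Fin nr) (Fin r ⊕ Fin nr) ℝ) (ε : ℝ) :
    Matrix (Fin nr) (Fin nr) ℝ :=
  ε • (1 : Matrix (Fin nr) (Fin nr) ℝ) + Sm.toBlocks₂₂ +
    (Cm.toBlocks₂₂)ᵀ * (Qm.toBlocks₂₂)⁻¹ * Cm.toBlocks₂₂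

/-- `C(t,ε) = −C1' + C3'Q4⁻¹Q2' + A M B`, `M = W(t,ε)⁻¹`. -/
def blkC (Cm : Matrix (Fin r ⊕ Fin mr) (Fin r ⊕ Fin nr) ℝ)
    (Qm : Matrix (Fin r ⊕ Fin mr) (Fin r ⊕ Fin mr) ℝ)
    (Sm : Matrix (Fin r ⊕ Fin nr) (Fin r ⊕ Fin nr) ℝ) (ε : ℝ) :
    Matrix (Fin r) (Fin r) ℝ :=
  -(Cm.toBlocks₁₁)ᵀ + (Cm.toBlocks₂₁)ᵀ * (Qm.toBlocks₂₂)⁻¹ * (Qm.toBlocks₁₂)ᵀ +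
    blkA Cm Qm Sm * (blkW Cm Qm Sm ε)⁻¹ * blkB Cm Qm

/-- `Q(t,ε) = −(1/ε)AMA' + I + (1/ε)(S1 + C3'Q4⁻¹C3)`. -/
def blkQ (Cm : Matrix (Fin r ⊕ Fin mr) (Fin r ⊕ Fin nr) ℝ)
    (Qm : Matrix (Fin r ⊕ Fin mr) (Fin r ⊕ Fin mr) ℝ)
    (Sm : Matrix (Fin r ⊕ Fin nr) (Fin r ⊕ Fin nr) ℝ) (ε : ℝ) :
    Matrix (Fin r) (Fin r) ℝ :=
  -((1 / ε) • (blkA Cm Qm Sm * (blkW Cm Qm Sm ε)⁻¹ * (blkA Cm Qm Sm)ᵀ)) + 1 +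
    (1 / ε) • (Sm.toBlocks₁₁ + (Cm.toBlocks₂₁)ᵀ * (Qm.toBlocks₂₂)⁻¹ * Cm.toBlocks₂₁)

/-- `S(t,ε) = ε(Q1 − Q2Q4⁻¹Q2' + B'MB)`. -/
def blkS (Cm : Matrix (Fin r ⊕ Fin mr) (Fin r ⊕ Fin nr) ℝ)
    (Qm : Matrix (Fin r ⊕ Fin mr) (Fin r ⊕ Fin mr) ℝ)
    (Sm : Matrix (Fin r ⊕ Fin nr) (Fin r ⊕ Fin nr) ℝ) (ε : ℝ) :
    Matrix (Fin r) (Fin r) ℝ :=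
  ε • (Qm.toBlocks₁₁ - Qm.toBlocks₁₂ * (Qm.toBlocks₂₂)⁻¹ * (Qm.toBlocks₁₂)ᵀ +
    (blkB Cm Qm)ᵀ * (blkW Cm Qm Sm ε)⁻¹ * blkB Cm Qm)

end BlockDefs

/-- `x : ℝ → E` is (a representative of an element of) `L²(t0,T;E)`. -/
def L2On {E : Type*} [NormedAddCommGroup E] (t0 T : ℝ) (x : ℝ → E) : Prop :=
  MeasureTheory.AEStronglyMeasurable x (MeasureTheory.volume.restrict (Icc t0 T)) ∧
    MeasureTheory.IntegrableOn (fun t => ‖x t‖ ^ 2) (Icc t0 T) MeasureTheory.volume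

attribute [local instance] Matrix.normedAddCommGroup Matrix.normedSpace

theorem ContinuousOn.matrix_mul {l m n : Type*} [Fintype m] {s : Set ℝ} {A : ℝ → Matrix l m ℝ}
    {B : ℝ → Matrix m n ℝ} (hA : ContinuousOn A s) (hB : ContinuousOn B s) :
    ContinuousOn (fun t => A t * B t) s :=
  (continuous_fst.matrix_mul continuous_snd).comp_continuousOn (hA.prodMk hB)

theorem ContinuousOn.matrix_mulVec {m n : Type*} [Fintype n] {s : Set ℝ} {A : ℝ → Matrix m n ℝ}
    {v : ℝ → n → ℝ} (hA : ContinuousOn A s) (hv : ContinuousOn v s) :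
    ContinuousOn (fun t => A t *ᵥ v t) s :=
  (continuous_fst.matrix_mulVec continuous_snd).comp_continuousOn (hA.prodMk hv)

theorem norm_mul_le_card_mul {l m n : Type*} [Fintype l] [Fintype m] [Fintype n]
    (A : Matrix l m ℝ) (B : Matrix m n ℝ) : ‖A * B‖ ≤ Fintype.card m * ‖A‖ * ‖B‖ := by
  refine (Matrix.norm_le_iff (by positivity)).2 fun i j => ?_
  rw [Matrix.mul_apply]
  calc ‖∑ k, A i k * B k j‖ ≤ ∑ _k : m, ‖A‖ * ‖B‖ := by
        refine norm_sum_le_of_le _ fun k _ => ?_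
        rw [norm_mul]
        exact mul_le_mul (Matrix.norm_entry_le_entrywise_sup_norm A)
          (Matrix.norm_entry_le_entrywise_sup_norm B) (norm_nonneg _) (norm_nonneg _)
    _ = Fintype.card m * ‖A‖ * ‖B‖ := by simp [mul_assoc]

/-- A solution of the linear equation `D' = D X + Y D` with zero initial value vanishes. -/
theorem eq_zero_of_hasDerivWithinAt_mul_add_mul {n : Type*} [Fintype n] {a b : ℝ}
    {D X Y : ℝ → Matrix n n ℝ} (hX : ContinuousOn X (Icc a b)) (hY : ContinuousOn Y (Icc a b))
    (hD : ∀ t ∈ Icc a b, HasDerivWithinAt D (D t * X t + Y t * D t) (Icc a b) t)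
    (h0 : D a = 0) : ∀ t ∈ Icc a b, D t = 0 := by
  obtain ⟨cX, hcX⟩ := isCompact_Icc.exists_bound_of_continuousOn hX
  obtain ⟨cY, hcY⟩ := isCompact_Icc.exists_bound_of_continuousOn hY
  refine eq_zero_of_abs_deriv_le_mul_abs_self_of_eq_zero_right
    (K := Fintype.card n * cX + Fintype.card n * cY)
    (fun t ht => (hD t ht).continuousWithinAt)
    (fun t ht => (hD t (Ico_subset_Icc_self ht)).mono_of_mem_nhdsWithin (Icc_mem_nhdsGE_of_mem ht))
    h0 fun t ht => ?_
  have ht' := Ico_subset_Icc_self ht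
  calc ‖D t * X t + Y t * D t‖
      ≤ Fintype.card n * ‖D t‖ * ‖X t‖ + Fintype.card n * ‖Y t‖ * ‖D t‖ :=
        norm_add_le_of_le (norm_mul_le_card_mul _ _) (norm_mul_le_card_mul _ _)
    _ ≤ Fintype.card n * ‖D t‖ * cX + Fintype.card n * cY * ‖D t‖ := by
        gcongr
        · exact hcX t ht'
        · exact hcY t ht'
    _ = _ := by ring

theorem HasDerivWithinAt.transpose_matrix {m n : Type*} [Fintype m] [Fintype n]
    {K : ℝ → Matrix m n ℝ} {K' : Matrix m n ℝ} {s : Set ℝ} {t : ℝ}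
    (h : HasDerivWithinAt K K' s t) : HasDerivWithinAt (fun u => (K u)ᵀ) K'ᵀ s t :=
  hasDerivWithinAt_pi.2 fun j => hasDerivWithinAt_pi.2 fun i =>
    hasDerivWithinAt_pi.1 (hasDerivWithinAt_pi.1 h i) j

/-- A Riccati solution with symmetric coefficients and zero initial value is symmetric. -/
theorem isSymm_of_riccati {n : Type*} [Fintype n] {a b : ℝ} {K A P S : ℝ → Matrix n n ℝ}
    (hA : ContinuousOn A (Icc a b)) (hP : ContinuousOn P (Icc a b))
    (hPs : ∀ t ∈ Icc a b, (P t).IsSymm) (hSs : ∀ t ∈ Icc a b, (S t).IsSymm) (h0 : K a = 0)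
    (hK : ∀ t ∈ Icc a b, HasDerivWithinAt K
      (-(K t * A t) - (A t)ᵀ * K t - K t * P t * K t + S t) (Icc a b) t) :
    ∀ t ∈ Icc a b, (K t).IsSymm := by
  have hKc : ContinuousOn K (Icc a b) := fun t ht => (hK t ht).continuousWithinAt
  have hKt : ContinuousOn (fun t => (K t)ᵀ) (Icc a b) :=
    continuous_id.matrix_transpose.comp_continuousOn hKc
  have hAt : ContinuousOn (fun t => (A t)ᵀ) (Icc a b) :=
    continuous_id.matrix_transpose.comp_continuousOn hA
  have key := eq_zero_of_hasDerivWithinAt_mul_add_mul (D := fun t => K t - (K t)ᵀ)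
    (X := fun t => -(A t + P t * K t)) (Y := fun t => -((A t)ᵀ + (K t)ᵀ * P t))
    (hA.add (hP.matrix_mul hKc)).neg (hAt.add (hKt.matrix_mul hP)).neg ?_ (by simp [h0])
  · exact fun t ht => (sub_eq_zero.1 (key t ht)).symm
  · intro t ht
    refine ((hK t ht).sub (hK t ht).transpose_matrix).congr_deriv ?_
    simp only [transpose_add, transpose_sub, transpose_neg, transpose_mul, transpose_transpose,
      (hPs t ht).eq, (hSs t ht).eq]
    noncomm_ring

theorem continuousOn_matrix_inv {n : Type*} [Fintype n] [DecidableEq n] {s : Set ℝ}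
    {A : ℝ → Matrix n n ℝ} (hA : ContinuousOn A s) (hu : ∀ t ∈ s, (A t).PosDef) :
    ContinuousOn (fun t => (A t)⁻¹) s := fun t ht =>
  (continuousAt_matrix_inv (A t) (by
    rw [Ring.inverse_eq_inv']
    exact continuousAt_inv₀ (hu t ht).det_pos.ne')).comp_continuousWithinAt (hA t ht)

theorem integrableOn_mulVec {m n : Type*} [Fintype m] [Fintype n] {a b : ℝ}
    {A : ℝ → Matrix m n ℝ} {y : ℝ → n → ℝ} (hA : ContinuousOn A (Icc a b))
    (hy : MeasureTheory.IntegrableOn y (Icc a b)) :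
    MeasureTheory.IntegrableOn (fun t => A t *ᵥ y t) (Icc a b) := by
  refine MeasureTheory.Integrable.of_eval fun i => ?_
  refine MeasureTheory.integrable_finsetSum _ fun j _ => ?_
  have hAij : ContinuousOn (fun t => A t i j) (Icc a b) :=
    (continuous_id.matrix_elem i j).comp_continuousOn hA
  exact MeasureTheory.IntegrableOn.continuousOn_mul hAij (hy.eval j) isCompact_Icc

theorem L2On.integrableOn {E : Type*} [NormedAddCommGroup E] {a b : ℝ} {y : ℝ → E}
    (hy : L2On a b y) : MeasureTheory.IntegrableOn y (Icc a b) :=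
  ((MeasureTheory.memLp_two_iff_integrable_sq_norm hy.1).2 hy.2).integrable one_le_two

/-- Integration by parts for a `C¹` function against a primitive of an integrable function. -/
theorem integral_mul_primitive {a b : ℝ} (hab : a ≤ b) {z z' g x : ℝ → ℝ}
    (hz : ∀ t ∈ Icc a b, HasDerivWithinAt z (z' t) (Icc a b) t)
    (hz' : ContinuousOn z' (Icc a b)) (hg : IntervalIntegrable g MeasureTheory.volume a b)
    (hx : ∀ t ∈ Icc a b, x t = ∫ s in a..t, g s) :
    ∫ t in a..b, (z' t * x t + z t * g t) = z b * x b := by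
  obtain ⟨c, hc⟩ := isCompact_Icc.exists_bound_of_continuousOn hz'
  have hzac : AbsolutelyContinuousOnInterval z a b := by
    refine LipschitzOnWith.absolutelyContinuousOnInterval (K := c.toNNReal) ?_
    rw [uIcc_of_le hab]
    refine (convex_Icc a b).lipschitzOnWith_of_nnnorm_hasDerivWithin_le hz fun t ht => ?_
    exact NNReal.le_toNNReal_of_coe_le (hc t ht)
  have hgac := hg.absolutelyContinuousOnInterval_intervalIntegral (c := a) left_mem_uIcc
  have key := hzac.integral_deriv_mul_eq_sub hgac
  rw [intervalIntegral.integral_same, mul_zero, sub_zero, ← hx b (right_mem_Icc.2 hab)] at key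
  rw [← key]
  refine intervalIntegral.integral_congr_ae ?_
  filter_upwards [hg.ae_hasDerivAt_integral, MeasureTheory.Measure.ae_ne MeasureTheory.volume b]
    with t ht htb hmem
  have htu := uIoc_subset_uIcc hmem
  rw [(ht htu a left_mem_uIcc).deriv]
  rw [uIoc_of_le hab] at hmem
  rw [((hz t (Ioc_subset_Icc_self hmem)).hasDerivAt
    (Icc_mem_nhds hmem.1 (lt_of_le_of_ne hmem.2 htb))).deriv, hx t (Ioc_subset_Icc_self hmem)]

theorem integral_dotProduct_primitive {ι : Type*} [Fintype ι] {a b : ℝ} (hab : a ≤ b)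
    {z z' g x : ℝ → ι → ℝ} (hz : ∀ t ∈ Icc a b, HasDerivWithinAt z (z' t) (Icc a b) t)
    (hz' : ContinuousOn z' (Icc a b)) (hg : MeasureTheory.IntegrableOn g (Icc a b))
    (hxc : ContinuousOn x (Icc a b)) (hx : ∀ t ∈ Icc a b, x t = ∫ s in a..t, g s) :
    ∫ t in a..b, (z' t ⬝ᵥ x t + z t ⬝ᵥ g t) = z b ⬝ᵥ x b := by
  have hgi : ∀ i, MeasureTheory.IntegrableOn (fun t => g t i) (Icc a b) := fun i => hg.eval i
  have hzc : ContinuousOn z (Icc a b) := fun t ht => (hz t ht).continuousWithinAt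
  simp only [dotProduct, ← Finset.sum_add_distrib]
  rw [intervalIntegral.integral_finsetSum]
  · refine Finset.sum_congr rfl fun i _ => ?_
    refine integral_mul_primitive hab (fun t ht => hasDerivWithinAt_pi.1 (hz t ht) i)
      (continuousOn_pi.1 hz' i)
      ((intervalIntegrable_iff_integrableOn_Icc_of_le hab).2 (hgi i)) fun t ht => ?_
    have hgt : IntervalIntegrable g MeasureTheory.volume a t :=
      (intervalIntegrable_iff_integrableOn_Icc_of_le ht.1).2
        (hg.mono_set (Icc_subset_Icc_right ht.2))
    rw [hx t ht]
    exact ((ContinuousLinearMap.proj (R := ℝ) (φ := fun _ : ι => ℝ) i).intervalIntegral_comp_comm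
      hgt).symm
  · intro i _
    refine (intervalIntegrable_iff_integrableOn_Icc_of_le hab).2 (MeasureTheory.Integrable.add ?_ ?_)
    · exact ((continuousOn_pi.1 hz' i).mul (continuousOn_pi.1 hxc i)).integrableOn_Icc
    · exact MeasureTheory.IntegrableOn.continuousOn_mul (continuousOn_pi.1 hzc i) (hgi i)
        isCompact_Icc

section BlockLemmas

variable {r mr nr : ℕ}

theorem posDef_toBlocks₂₂ {m n : Type*} {Q : Matrix (m ⊕ n) (m ⊕ n) ℝ} (hQ : Q.PosDef) :
    Q.toBlocks₂₂.PosDef :=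
  hQ.submatrix Sum.inr_injective

theorem blkW_posDef (Cm : Matrix (Fin r ⊕ Fin mr) (Fin r ⊕ Fin nr) ℝ)
    {Qm : Matrix (Fin r ⊕ Fin mr) (Fin r ⊕ Fin mr) ℝ}
    {Sm : Matrix (Fin r ⊕ Fin nr) (Fin r ⊕ Fin nr) ℝ} {ε : ℝ} (hε : 0 < ε)
    (hQ : Qm.PosDef) (hS : Sm.PosSemidef) : (blkW Cm Qm Sm ε).PosDef := by
  refine ((Matrix.PosDef.one.smul hε).add_posSemidef (hS.submatrix Sum.inr)).add_posSemidef ?_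
  simpa using (posDef_toBlocks₂₂ hQ).inv.posSemidef.conjTranspose_mul_mul_same Cm.toBlocks₂₂

theorem transpose_inv_of_posDef {n : Type*} [Fintype n] [DecidableEq n] {A : Matrix n n ℝ}
    (hA : A.PosDef) : (A⁻¹)ᵀ = A⁻¹ := by
  simpa [Matrix.IsHermitian] using hA.inv.isHermitian

theorem blkQ_isSymm (Cm : Matrix (Fin r ⊕ Fin mr) (Fin r ⊕ Fin nr) ℝ)
    {Qm : Matrix (Fin r ⊕ Fin mr) (Fin r ⊕ Fin mr) ℝ}
    {Sm : Matrix (Fin r ⊕ Fin nr) (Fin r ⊕ Fin nr) ℝ} {ε : ℝ} (hε : 0 < ε)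
    (hQ : Qm.PosDef) (hS : Sm.PosSemidef) : (blkQ Cm Qm Sm ε).IsSymm := by
  have hS₁ : (Sm.toBlocks₁₁)ᵀ = Sm.toBlocks₁₁ := (hS.submatrix Sum.inl).isHermitian
  simp only [Matrix.IsSymm, blkQ, transpose_add, transpose_neg, transpose_smul, transpose_mul,
    transpose_transpose, transpose_one, transpose_inv_of_posDef (posDef_toBlocks₂₂ hQ),
    transpose_inv_of_posDef (blkW_posDef Cm hε hQ hS), hS₁, Matrix.mul_assoc]

theorem blkS_isSymm (Cm : Matrix (Fin r ⊕ Fin mr) (Fin r ⊕ Fin nr) ℝ)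
    {Qm : Matrix (Fin r ⊕ Fin mr) (Fin r ⊕ Fin mr) ℝ}
    {Sm : Matrix (Fin r ⊕ Fin nr) (Fin r ⊕ Fin nr) ℝ} {ε : ℝ} (hε : 0 < ε)
    (hQ : Qm.PosDef) (hS : Sm.PosSemidef) : (blkS Cm Qm Sm ε).IsSymm := by
  have hQ₁ : (Qm.toBlocks₁₁)ᵀ = Qm.toBlocks₁₁ :=
    (hQ.posSemidef.submatrix Sum.inl).isHermitian
  simp only [Matrix.IsSymm, blkS, transpose_add, transpose_sub, transpose_smul, transpose_mul,
    transpose_transpose, transpose_inv_of_posDef (posDef_toBlocks₂₂ hQ),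
    transpose_inv_of_posDef (blkW_posDef Cm hε hQ hS), hQ₁, Matrix.mul_assoc]

variable {s : Set ℝ} {C : ℝ → Matrix (Fin r ⊕ Fin mr) (Fin r ⊕ Fin nr) ℝ}
  {Q : ℝ → Matrix (Fin r ⊕ Fin mr) (Fin r ⊕ Fin mr) ℝ}
  {S : ℝ → Matrix (Fin r ⊕ Fin nr) (Fin r ⊕ Fin nr) ℝ} {ε : ℝ}

theorem continuousOn_submatrix {l m n o : Type*} {A : ℝ → Matrix m n ℝ} (hA : ContinuousOn A s)
    (e : l → m) (f : o → n) : ContinuousOn (fun t => (A t).submatrix e f) s :=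
  (continuous_id.matrix_submatrix e f).comp_continuousOn hA

theorem continuousOn_transpose {m n : Type*} {A : ℝ → Matrix m n ℝ} (hA : ContinuousOn A s) :
    ContinuousOn (fun t => (A t)ᵀ) s :=
  continuous_id.matrix_transpose.comp_continuousOn hA

theorem continuousOn_inv_toBlocks₂₂ (hQ : ContinuousOn Q s) (hQpd : ∀ t ∈ s, (Q t).PosDef) :
    ContinuousOn (fun t => ((Q t).toBlocks₂₂)⁻¹) s :=
  continuousOn_matrix_inv (continuousOn_submatrix hQ Sum.inr Sum.inr)
    fun t ht => posDef_toBlocks₂₂ (hQpd t ht)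

theorem continuousOn_blkA (hC : ContinuousOn C s) (hQ : ContinuousOn Q s)
    (hQpd : ∀ t ∈ s, (Q t).PosDef) (hS : ContinuousOn S s) :
    ContinuousOn (fun t => blkA (C t) (Q t) (S t)) s :=
  (((continuousOn_transpose (continuousOn_submatrix hC Sum.inr Sum.inl)).matrix_mul
    (continuousOn_inv_toBlocks₂₂ hQ hQpd)).matrix_mul
    (continuousOn_submatrix hC Sum.inr Sum.inr)).add (continuousOn_submatrix hS Sum.inl Sum.inr)

theorem continuousOn_blkB (hC : ContinuousOn C s) (hQ : ContinuousOn Q s)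
    (hQpd : ∀ t ∈ s, (Q t).PosDef) : ContinuousOn (fun t => blkB (C t) (Q t)) s :=
  (continuousOn_transpose (continuousOn_submatrix hC Sum.inl Sum.inr)).sub
    (((continuousOn_transpose (continuousOn_submatrix hC Sum.inr Sum.inr)).matrix_mul
    (continuousOn_inv_toBlocks₂₂ hQ hQpd)).matrix_mul
    (continuousOn_transpose (continuousOn_submatrix hQ Sum.inl Sum.inr)))

theorem continuousOn_inv_blkW (hε : 0 < ε) (hC : ContinuousOn C s) (hQ : ContinuousOn Q s)
    (hQpd : ∀ t ∈ s, (Q t).PosDef) (hS : ContinuousOn S s) (hSpsd : ∀ t ∈ s, (S t).PosSemidef) :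
    ContinuousOn (fun t => (blkW (C t) (Q t) (S t) ε)⁻¹) s :=
  continuousOn_matrix_inv ((continuousOn_const.add (continuousOn_submatrix hS Sum.inr Sum.inr)).add
    (((continuousOn_transpose (continuousOn_submatrix hC Sum.inr Sum.inr)).matrix_mul
    (continuousOn_inv_toBlocks₂₂ hQ hQpd)).matrix_mul (continuousOn_submatrix hC Sum.inr Sum.inr)))
    fun t ht => blkW_posDef (C t) hε (hQpd t ht) (hSpsd t ht)

theorem continuousOn_blkC (hε : 0 < ε) (hC : ContinuousOn C s) (hQ : ContinuousOn Q s)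
    (hQpd : ∀ t ∈ s, (Q t).PosDef) (hS : ContinuousOn S s) (hSpsd : ∀ t ∈ s, (S t).PosSemidef) :
    ContinuousOn (fun t => blkC (C t) (Q t) (S t) ε) s :=
  ((continuousOn_transpose (continuousOn_submatrix hC Sum.inl Sum.inl)).neg.add
    (((continuousOn_transpose (continuousOn_submatrix hC Sum.inr Sum.inl)).matrix_mul
    (continuousOn_inv_toBlocks₂₂ hQ hQpd)).matrix_mul
    (continuousOn_transpose (continuousOn_submatrix hQ Sum.inl Sum.inr)))).add
    (((continuousOn_blkA hC hQ hQpd hS).matrix_mul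
    (continuousOn_inv_blkW hε hC hQ hQpd hS hSpsd)).matrix_mul (continuousOn_blkB hC hQ hQpd))

theorem continuousOn_blkQ (hε : 0 < ε) (hC : ContinuousOn C s) (hQ : ContinuousOn Q s)
    (hQpd : ∀ t ∈ s, (Q t).PosDef) (hS : ContinuousOn S s) (hSpsd : ∀ t ∈ s, (S t).PosSemidef) :
    ContinuousOn (fun t => blkQ (C t) (Q t) (S t) ε) s :=
  ((((((continuousOn_blkA hC hQ hQpd hS).matrix_mul
    (continuousOn_inv_blkW hε hC hQ hQpd hS hSpsd)).matrix_mul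
    (continuousOn_transpose (continuousOn_blkA hC hQ hQpd hS))).const_smul (1 / ε)).neg).add
    continuousOn_const).add
    (((continuousOn_submatrix hS Sum.inl Sum.inl).add
    (((continuousOn_transpose (continuousOn_submatrix hC Sum.inr Sum.inl)).matrix_mul
    (continuousOn_inv_toBlocks₂₂ hQ hQpd)).matrix_mul
    (continuousOn_submatrix hC Sum.inr Sum.inl))).const_smul (1 / ε))

theorem continuousOn_fromRows {m₁ m₂ n : Type*} {A : ℝ → Matrix m₁ n ℝ} {B : ℝ → Matrix m₂ n ℝ}
    (hA : ContinuousOn A s) (hB : ContinuousOn B s) :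
    ContinuousOn (fun t => Matrix.fromRows (A t) (B t)) s := by
  refine continuousOn_pi.2 fun i => ?_
  cases i with
  | inl i => exact continuousOn_pi.1 hA i
  | inr i => exact continuousOn_pi.1 hB i

end BlockLemmas

/-- representation identity in the proof of Corollary 1: the suboptimal
estimation is realized by a recursive filter. With `K(·,ε)` the Riccati solution,
`z1` the terminal-value solution of `z1' = (C(·,ε) + Q(·,ε)K)z1`,
`Φ(t,ε) = [K(t,ε); M(t,ε)(εB(t) − A'(t)K(t,ε))]` and `p̂ = Φz1`, for every
`y ∈ L²(t0,T;ℝᵖ)` one has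
`∫_{t0}^T ⟨(1/ε)R H p̂, y⟩ dt = ⟨(I + K(T,ε))⁻¹ℓ1, x̂(T)⟩`, where
`x̂' = (−C'(·,ε) − K Q(·,ε))x̂ + (1/ε)Φ'H'Ry`, `x̂(t0) = 0`. -/
theorem suboptimal_filter_representation {r mr nr q : ℕ} (hr : 0 < r)
    (t0 T : ℝ) (hT : t0 < T)
    (C : ℝ → Matrix (Fin r ⊕ Fin mr) (Fin r ⊕ Fin nr) ℝ)
    (hC : ContinuousOn C (Icc t0 T))
    (H : ℝ → Matrix (Fin q) (Fin r ⊕ Fin nr) ℝ) (hH : ContinuousOn H (Icc t0 T))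
    (Q : ℝ → Matrix (Fin r ⊕ Fin mr) (Fin r ⊕ Fin mr) ℝ)
    (hQ : ContinuousOn Q (Icc t0 T)) (hQpd : ∀ t ∈ Icc t0 T, (Q t).PosDef)
    (R : ℝ → Matrix (Fin q) (Fin q) ℝ)
    (hR : ContinuousOn R (Icc t0 T)) (hRpd : ∀ t ∈ Icc t0 T, (R t).PosDef)
    (ε : ℝ) (hε : 0 < ε) (ℓ1 : Fin r → ℝ) (ℓ2 : Fin mr → ℝ)
    -- the Riccati solution `K(·,ε)`
    (K : ℝ → Matrix (Fin r) (Fin r) ℝ) (hK0 : K t0 = 0)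
    (hK : ∀ t ∈ Icc t0 T,
      HasDerivWithinAt K
        (-(K t * blkC (C t) (Q t) ((H t)ᵀ * R t * H t) ε) -
          (blkC (C t) (Q t) ((H t)ᵀ * R t * H t) ε)ᵀ * K t -
          K t * blkQ (C t) (Q t) ((H t)ᵀ * R t * H t) ε * K t +
          blkS (C t) (Q t) ((H t)ᵀ * R t * H t) ε)
        (Icc t0 T) t)
    -- the adjoint solution `z1`
    (z1 : ℝ → (Fin r → ℝ)) (hz1T : z1 T = (1 + K T)⁻¹ *ᵥ ℓ1)
    (hz1 : ∀ t ∈ Icc t0 T,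
      HasDerivWithinAt z1
        ((blkC (C t) (Q t) ((H t)ᵀ * R t * H t) ε +
          blkQ (C t) (Q t) ((H t)ᵀ * R t * H t) ε * K t) *ᵥ z1 t)
        (Icc t0 T) t)
    -- the block column `Φ(t,ε) = [K; M(εB − A'K)]`
    (Φ : ℝ → Matrix (Fin r ⊕ Fin nr) (Fin r) ℝ)
    (hΦ : ∀ t, Φ t = Matrix.fromRows (K t)
      ((blkW (C t) (Q t) ((H t)ᵀ * R t * H t) ε)⁻¹ *
        (ε • blkB (C t) (Q t) - (blkA (C t) (Q t) ((H t)ᵀ * R t * H t))ᵀ * K t)))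
    -- an arbitrary realization of the observations
    (y : ℝ → (Fin q → ℝ)) (hy : L2On t0 T y)
    -- the filter `x̂`
    (xh : ℝ → (Fin r → ℝ)) (hxhC : ContinuousOn xh (Icc t0 T))
    (hxh : ∀ t ∈ Icc t0 T,
      xh t = ∫ s in t0..t,
        ((-(blkC (C s) (Q s) ((H s)ᵀ * R s * H s) ε)ᵀ -
            K s * blkQ (C s) (Q s) ((H s)ᵀ * R s * H s) ε) *ᵥ xh s +
          (1 / ε) • ((Φ s)ᵀ *ᵥ ((H s)ᵀ *ᵥ (R s *ᵥ y s))))) :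
    (∫ t in t0..T, ((1 / ε) • (R t *ᵥ (H t *ᵥ (Φ t *ᵥ z1 t)))) ⬝ᵥ y t) =
      ((1 + K T)⁻¹ *ᵥ ℓ1) ⬝ᵥ xh T := by
  set S : ℝ → Matrix (Fin r ⊕ Fin nr) (Fin r ⊕ Fin nr) ℝ := fun t => (H t)ᵀ * R t * H t
  have hSc : ContinuousOn S (Icc t0 T) :=
    ((continuousOn_transpose hH).matrix_mul hR).matrix_mul hH
  have hSpsd : ∀ t ∈ Icc t0 T, (S t).PosSemidef := fun t ht => by
    simpa using (hRpd t ht).posSemidef.conjTranspose_mul_mul_same (H t)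
  have hCc := continuousOn_blkC hε hC hQ hQpd hSc hSpsd
  have hQc := continuousOn_blkQ hε hC hQ hQpd hSc hSpsd
  have hQs : ∀ t ∈ Icc t0 T, (blkQ (C t) (Q t) (S t) ε).IsSymm := fun t ht =>
    blkQ_isSymm (C t) hε (hQpd t ht) (hSpsd t ht)
  have hKs : ∀ t ∈ Icc t0 T, (K t).IsSymm :=
    isSymm_of_riccati hCc hQc hQs
      (fun t ht => blkS_isSymm (C t) hε (hQpd t ht) (hSpsd t ht)) hK0 hK
  have hRs : ∀ t ∈ Icc t0 T, (R t)ᵀ = R t := fun t ht => by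
    simpa [Matrix.IsHermitian] using (hRpd t ht).isHermitian
  have hKc : ContinuousOn K (Icc t0 T) := fun t ht => (hK t ht).continuousWithinAt
  have hzc : ContinuousOn z1 (Icc t0 T) := fun t ht => (hz1 t ht).continuousWithinAt
  have hΦc : ContinuousOn Φ (Icc t0 T) := by
    rw [funext hΦ]
    exact continuousOn_fromRows hKc ((continuousOn_inv_blkW hε hC hQ hQpd hSc hSpsd).matrix_mul
      (((continuousOn_blkB hC hQ hQpd).const_smul ε).sub
        ((continuousOn_transpose (continuousOn_blkA hC hQ hQpd hSc)).matrix_mul hKc)))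
  have hzc' := (hCc.add (hQc.matrix_mul hKc)).matrix_mulVec hzc
  have hgi := (integrableOn_mulVec ((continuousOn_transpose hCc).neg.sub (hKc.matrix_mul hQc))
    hxhC.integrableOn_Icc).add ((integrableOn_mulVec (continuousOn_transpose hΦc)
      (integrableOn_mulVec (continuousOn_transpose hH)
        (integrableOn_mulVec hR hy.integrableOn))).smul (1 / ε))
  have key := integral_dotProduct_primitive hT.le hz1 hzc' hgi hxhC hxh
  rw [← hz1T, ← key]
  refine intervalIntegral.integral_congr fun t ht => ?_
  rw [uIcc_of_le hT.le] at ht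
  have hadj : ((blkC (C t) (Q t) (S t) ε + blkQ (C t) (Q t) (S t) ε * K t) *ᵥ z1 t) ⬝ᵥ xh t =
      -(z1 t ⬝ᵥ ((-(blkC (C t) (Q t) (S t) ε)ᵀ - K t * blkQ (C t) (Q t) (S t) ε) *ᵥ xh t)) := by
    rw [dotProduct_comm, dotProduct_mulVec, ← mulVec_transpose, transpose_add, transpose_mul,
      (hQs t ht).eq, (hKs t ht).eq, dotProduct_comm, ← dotProduct_neg, ← neg_mulVec]
    congr 2
    abel
  have hobs : (R t *ᵥ (H t *ᵥ (Φ t *ᵥ z1 t))) ⬝ᵥ y t =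
      z1 t ⬝ᵥ ((Φ t)ᵀ *ᵥ ((H t)ᵀ *ᵥ (R t *ᵥ y t))) := by
    simp only [dotProduct_mulVec, vecMul_transpose]
    rw [← mulVec_transpose, hRs t ht]
  simp only [Pi.add_apply, Pi.sub_apply, Pi.neg_apply, Pi.smul_apply]
  rw [dotProduct_add, hadj, smul_dotProduct, hobs, dotProduct_smul,
    neg_add_cancel_left]
end
end
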